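/- For all integers 1 ≤ k ≤ n, N_{k,n} = Σ_{d | gcd(k,n)} μ(d)·C(n/d, k/d), where the sum runs over all positive divisors d of gcd(k,n) and μ is the Möbius function. -/

import Mathlib

/-- A Young diagram inscribed in a `k × (n-k)` rectangle: a weakly decreasing
sequence `λ₁ ≥ … ≥ λ_k` (0-indexed) with all entries `≤ n - k`. -/
def IsDiagram (k n : ℕ) (lam : Fin k → ℕ) : Prop :=
  (∀ i j : Fin k, i ≤ j → lam j ≤ lam i) ∧ ∀ i, lam i ≤ n - k

/-- The cyclic step map `σ` on diagrams: add one box to every row if the first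
row is shorter than `n - k`, otherwise drop the first row and append a zero row. -/
def cyc (k n : ℕ) (lam : Fin k → ℕ) : Fin k → ℕ :=
  if ∀ i, lam i < n - k then fun i => lam i + 1
  else fun i => if h : (i : ℕ) + 1 < k then lam ⟨(i : ℕ) + 1, h⟩ else 0

/-- The orbit length `o(λ)`: the least positive `t` with `σ^[t] λ = λ`. -/
noncomputable def orbLen (k n : ℕ) (lam : Fin k → ℕ) : ℕ :=
  sInf {t | 0 < t ∧ (cyc k n)^[t] lam = lam}

/-- Upper triangular diagram: `k·λᵢ ≤ (n-k)(k-i)` for all `i` (1-indexed). -/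
def IsUpper (k n : ℕ) (lam : Fin k → ℕ) : Prop :=
  ∀ i : Fin k, k * lam i ≤ (n - k) * (k - 1 - (i : ℕ))

/-- Lexicographic (non-strict) comparison of diagrams. -/
def lexLE {k : ℕ} (lam mu : Fin k → ℕ) : Prop :=
  lam = mu ∨ ∃ t : Fin k, (∀ i, i < t → lam i = mu i) ∧ lam t < mu t

/-- Minimal upper triangular diagram: upper triangular and lexicographically
smallest among the upper triangular diagrams in its `σ`-orbit. -/
def IsMinUpper (k n : ℕ) (lam : Fin k → ℕ) : Prop :=
  IsUpper k n lam ∧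
    ∀ t : ℕ, IsUpper k n ((cyc k n)^[t] lam) → lexLE lam ((cyc k n)^[t] lam)

/-- The binary word of a diagram: position `j` (0-indexed) carries the symbol `0`
(encoded as `false`) iff `j = λ_{k-i} + i` for some `0 ≤ i ≤ k-1` (0-indexed). -/
def word (k n : ℕ) (lam : Fin k → ℕ) (j : Fin n) : Bool :=
  !decide (∃ i : Fin k, (j : ℕ) = lam i.rev + (i : ℕ))

/-- A binary word of length `n` with exactly `k` zeros (`false` encodes `0`). -/
def IsWord (k n : ℕ) (w : Fin n → Bool) : Prop :=
  (Finset.univ.filter fun j => w j = false).card = k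

/-- Rotation of a binary word: `r(w)_j = w_{j+1}`, indices mod `n`. -/
def rot {n : ℕ} (w : Fin n → Bool) (j : Fin n) : Bool :=
  w ⟨((j : ℕ) + 1) % n, Nat.mod_lt _ j.pos⟩

/-- The diagram `θ_{k,km} = ((k-1)(m-1), (k-2)(m-1), …, (m-1), 0)`. -/
def theta (k m : ℕ) : Fin k → ℕ := fun i => (k - 1 - (i : ℕ)) * (m - 1)

/-- `N_{k,n}`: the number of diagrams in `Y_{k,n}` with full orbit `o(λ) = n`. -/
noncomputable def NN (k n : ℕ) : ℕ :=
  {lam : Fin k → ℕ | IsDiagram k n lam ∧ orbLen k n lam = n}.ncard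

open Function in
lemma orbLen_eq_minimalPeriod (k n : ℕ) (lam : Fin k → ℕ) :
    orbLen k n lam = minimalPeriod (cyc k n) lam := by
  classical
  by_cases h : lam ∈ periodicPts (cyc k n)
  · apply le_antisymm
    · exact Nat.sInf_le ⟨minimalPeriod_pos_of_mem_periodicPts h, isPeriodicPt_minimalPeriod _ _⟩
    · obtain ⟨t, ht, htp⟩ := h
      obtain ⟨h0, h1⟩ := Nat.sInf_mem (s := {t | 0 < t ∧ (cyc k n)^[t] lam = lam}) ⟨t, ht, htp⟩
      exact IsPeriodicPt.minimalPeriod_le h0 h1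
  · rw [minimalPeriod_eq_zero_of_notMem_periodicPts h, orbLen]
    convert Nat.sInf_empty
    ext t
    simp only [Set.mem_ofPred_eq, Set.mem_empty_iff_false, iff_false]
    exact fun ht => h ⟨t, ht.1, ht.2⟩

/-- Translation by one on finite subsets of `ZMod n`. -/
def shiftOne (n : ℕ) (S : Finset (ZMod n)) : Finset (ZMod n) := S.image (· + 1)

lemma iterate_shiftOne (n m : ℕ) (S : Finset (ZMod n)) :
    (shiftOne n)^[m] S = S.image (· + (m : ZMod n)) := by
  induction m with
  | zero => simp
  | succ m ih =>
    rw [Function.iterate_succ_apply', ih, shiftOne, Finset.image_image]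
    congr 1
    ext x
    simp [add_assoc]

/-- The positions `λ_{k-i} + i` of a diagram, as natural numbers. -/
def position {k : ℕ} (lam : Fin k → ℕ) (i : Fin k) : ℕ := lam i.rev + i

/-- The set of positions of a diagram modulo `n`. -/
def positionSet (k n : ℕ) (lam : Fin k → ℕ) : Finset (ZMod n) :=
  Finset.univ.image fun i => (position lam i : ZMod n)

lemma IsDiagram.strictMono_position {k n : ℕ} {lam : Fin k → ℕ} (h : IsDiagram k n lam) :
    StrictMono (position lam) := by
  intro i j hij
  have h1 := h.1 j.rev i.rev (Fin.rev_le_rev.2 hij.le)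
  have h2 : (i : ℕ) < j := hij
  simp only [position]
  omega

lemma IsDiagram.position_lt {k n : ℕ} {lam : Fin k → ℕ} (hkn : k ≤ n) (h : IsDiagram k n lam)
    (i : Fin k) : position lam i < n := by
  have h1 := h.2 i.rev
  have h2 := i.isLt
  simp only [position]
  omega

lemma IsDiagram.cyc {k n : ℕ} {lam : Fin k → ℕ} (h : IsDiagram k n lam) :
    IsDiagram k n (cyc k n lam) := by
  unfold _root_.cyc
  split_ifs with hc
  · exact ⟨fun i j hij => Nat.succ_le_succ (h.1 i j hij), fun i => hc i⟩
  · refine ⟨fun i j hij => ?_, fun i => ?_⟩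
    · have hij' : (i : ℕ) ≤ j := hij
      dsimp only
      split_ifs with h1 h2
      · exact h.1 _ _ (by simpa using hij')
      · omega
      · exact Nat.zero_le _
      · exact le_rfl
    · dsimp only
      split_ifs
      · exact h.2 _
      · exact Nat.zero_le _

lemma IsDiagram.iterate_cyc {k n : ℕ} {lam : Fin k → ℕ} (h : IsDiagram k n lam) (t : ℕ) :
    IsDiagram k n ((_root_.cyc k n)^[t] lam) := by
  induction t with
  | zero => exact h
  | succ t ih => rw [Function.iterate_succ_apply']; exact ih.cyc

lemma IsDiagram.card_positionSet {k n : ℕ} {lam : Fin k → ℕ} (hkn : k ≤ n)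
    (h : IsDiagram k n lam) : (positionSet k n lam).card = k := by
  rw [positionSet, Finset.card_image_of_injective, Finset.card_univ, Fintype.card_fin]
  intro i j hij
  apply h.strictMono_position.injective
  have := (ZMod.natCast_eq_natCast_iff' _ _ _).1 hij
  rwa [Nat.mod_eq_of_lt (h.position_lt hkn i), Nat.mod_eq_of_lt (h.position_lt hkn j)] at this

lemma positionSet_injOn {k n : ℕ} (hkn : k ≤ n) :
    Set.InjOn (positionSet k n) {lam | IsDiagram k n lam} := by
  intro a ha b hb hab
  have key : ∀ {a b : Fin k → ℕ}, IsDiagram k n a → IsDiagram k n b →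
      positionSet k n a = positionSet k n b →
      Set.range (position a) ⊆ Set.range (position b) := by
    rintro a b ha hb hab _ ⟨i, rfl⟩
    have : (position a i : ZMod n) ∈ positionSet k n b :=
      hab ▸ Finset.mem_image_of_mem _ (Finset.mem_univ i)
    obtain ⟨j, -, hj⟩ := Finset.mem_image.1 this
    have := (ZMod.natCast_eq_natCast_iff' _ _ _).1 hj
    rw [Nat.mod_eq_of_lt (ha.position_lt hkn i), Nat.mod_eq_of_lt (hb.position_lt hkn j)] at this
    exact ⟨j, this⟩
  have := (ha.strictMono_position.range_inj hb.strictMono_position).1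
    ((key ha hb hab).antisymm (key hb ha hab.symm))
  funext i
  simpa [position] using congrFun this i.rev

lemma exists_isDiagram_positionSet_eq {k n : ℕ} (hk : 1 ≤ k) (hkn : k ≤ n)
    {S : Finset (ZMod n)} (hS : S.card = k) : ∃ lam, IsDiagram k n lam ∧ positionSet k n lam = S := by
  have : NeZero n := ⟨by omega⟩
  have hT : (S.image ZMod.val).card = k := by
    rw [Finset.card_image_of_injective _ (ZMod.val_injective n), hS]
  set g := (S.image ZMod.val).orderEmbOfFin hT with hg
  have hgn : ∀ i, g i < n := fun i => by
    obtain ⟨x, -, hx⟩ := Finset.mem_image.1 ((S.image ZMod.val).orderEmbOfFin_mem hT i)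
    rw [hg, ← hx]
    exact x.val_lt
  have hstep : ∀ d (i j : Fin k), (i : ℕ) + d = j → g i + d ≤ g j := by
    intro d
    induction d with
    | zero => intro i j h; rw [Fin.ext (show (i : ℕ) = j by omega)]; rfl
    | succ d ih =>
      intro i j h
      have h1 := ih i ⟨i + d, by omega⟩ rfl
      have h2 : g ⟨i + d, by omega⟩ < g j := g.strictMono (Fin.mk_lt_of_lt_val (by omega))
      omega
  have hlow : ∀ i : Fin k, (i : ℕ) ≤ g i := fun i => by
    have := hstep i ⟨0, by omega⟩ i (by simp)
    omega
  have hpos : position (fun i : Fin k => g i.rev - i.rev) = g := by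
    funext i
    have := hlow i
    simp only [position, Fin.rev_rev]
    omega
  refine ⟨fun i => g i.rev - i.rev, ⟨fun i j hij => ?_, fun i => ?_⟩, ?_⟩
  · have h1 : (j.rev : ℕ) ≤ i.rev := Fin.rev_le_rev.2 hij
    have := hstep _ j.rev i.rev (Nat.add_sub_cancel' h1)
    dsimp only
    omega
  · have h1 := hstep (k - 1 - i.rev) i.rev ⟨k - 1, by omega⟩ (by dsimp only; omega)
    have h2 := hgn ⟨k - 1, by omega⟩
    dsimp only
    omega
  · have hr : Finset.univ.image g = S.image ZMod.val := by
      apply Finset.coe_injective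
      rw [Finset.coe_image, Finset.coe_univ, Set.image_univ, hg, Finset.range_orderEmbOfFin]
    rw [positionSet, hpos, show (fun i => (g i : ZMod n)) = (fun t : ℕ => (t : ZMod n)) ∘ g from rfl,
      ← Finset.image_image, hr, Finset.image_image]
    ext x
    simp

lemma IsDiagram.positionSet_cyc {k n : ℕ} {lam : Fin k → ℕ} (hk : 1 ≤ k) (hkn : k ≤ n)
    (h : IsDiagram k n lam) :
    positionSet k n (_root_.cyc k n lam) = shiftOne n (positionSet k n lam) := by
  by_cases hc : ∀ i, lam i < n - k
  · rw [positionSet, shiftOne, positionSet, Finset.image_image]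
    congr 1
    funext i
    simp only [_root_.cyc, if_pos hc, position, Function.comp]
    push_cast
    ring
  · refine Finset.eq_of_subset_of_card_le ?_ ?_
    · intro x hx
      obtain ⟨i, -, rfl⟩ := Finset.mem_image.1 hx
      simp only [shiftOne, positionSet, Finset.image_image, Finset.mem_image, Finset.mem_univ,
        true_and, Function.comp]
      by_cases hi : (i : ℕ) = 0
      · refine ⟨⟨k - 1, by omega⟩, ?_⟩
        have h0 : lam ⟨0, by omega⟩ = n - k := by
          push Not at hc
          obtain ⟨j, hj⟩ := hc
          have h1 := h.1 ⟨0, by omega⟩ j (Fin.mk_le_of_le_val (Nat.zero_le _))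
          have h2 := h.2 ⟨0, by omega⟩
          omega
        have hrev : Fin.rev (⟨k - 1, by omega⟩ : Fin k) = ⟨0, by omega⟩ := by
          ext; simp only [Fin.val_rev]; omega
        have hi' : ¬ ((i.rev : ℕ) + 1 < k) := by simp only [Fin.val_rev]; omega
        simp only [position, _root_.cyc, if_neg hc, hrev, h0, dif_neg hi', hi]
        rw [← Nat.cast_succ, show (n - k + (k - 1)).succ = n by omega]
        simp
      · refine ⟨⟨i - 1, by omega⟩, ?_⟩
        have hi' : (i.rev : ℕ) + 1 < k := by simp only [Fin.val_rev]; omega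
        have hrev : Fin.rev (⟨i - 1, by omega⟩ : Fin k) = ⟨i.rev + 1, hi'⟩ := by
          ext; simp only [Fin.val_rev]; omega
        simp only [position, _root_.cyc, if_neg hc, hrev, dif_pos hi']
        rw [← Nat.cast_succ]
        congr 1
        omega
    · rw [h.cyc.card_positionSet hkn]
      exact Finset.card_image_le.trans (h.card_positionSet hkn).le

lemma IsDiagram.positionSet_iterate_cyc {k n : ℕ} {lam : Fin k → ℕ} (hk : 1 ≤ k) (hkn : k ≤ n)
    (h : IsDiagram k n lam) (t : ℕ) :
    positionSet k n ((_root_.cyc k n)^[t] lam) = (shiftOne n)^[t] (positionSet k n lam) := by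
  induction t with
  | zero => rfl
  | succ t ih =>
    rw [Function.iterate_succ_apply', Function.iterate_succ_apply', (h.iterate_cyc t).positionSet_cyc
      hk hkn, ih]

lemma IsDiagram.orbLen_eq {k n : ℕ} {lam : Fin k → ℕ} (hk : 1 ≤ k) (hkn : k ≤ n)
    (h : IsDiagram k n lam) :
    orbLen k n lam = Function.minimalPeriod (shiftOne n) (positionSet k n lam) := by
  rw [orbLen_eq_minimalPeriod, Function.minimalPeriod_eq_minimalPeriod_iff]
  intro t
  rw [Function.IsPeriodicPt, Function.IsFixedPt, Function.IsPeriodicPt, Function.IsFixedPt,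
    ← h.positionSet_iterate_cyc hk hkn]
  exact ((positionSet_injOn hkn).eq_iff (h.iterate_cyc t) h).symm

lemma NN_eq_card_filter_minimalPeriod {k n : ℕ} [NeZero n] (hk : 1 ≤ k) (hkn : k ≤ n) :
    NN k n = ((Finset.univ.powersetCard k).filter fun S : Finset (ZMod n) =>
      Function.minimalPeriod (shiftOne n) S = n).card := by
  rw [← Set.ncard_coe_finset, NN]
  have hinj : Set.InjOn (positionSet k n) {lam | IsDiagram k n lam ∧ orbLen k n lam = n} :=
    (positionSet_injOn hkn).mono fun _ h => h.1
  rw [← hinj.ncard_image]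
  congr 1
  ext S
  simp only [Set.mem_image, Set.mem_ofPred_eq, Finset.coe_filter, Finset.mem_powersetCard_univ]
  constructor
  · rintro ⟨lam, ⟨h, ho⟩, rfl⟩
    exact ⟨h.card_positionSet hkn, by rw [← h.orbLen_eq hk hkn, ho]⟩
  · rintro ⟨hS, hp⟩
    obtain ⟨lam, h, rfl⟩ := exists_isDiagram_positionSet_eq hk hkn hS
    exact ⟨lam, ⟨h, by rw [h.orbLen_eq hk hkn, hp]⟩, rfl⟩

/-- The full preimage in `ZMod n` of a set of residues modulo a divisor `m` of `n`. -/
def residuePreimage {m n : ℕ} [NeZero n] (h : m ∣ n) (T : Finset (ZMod m)) : Finset (ZMod n) :=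
  Finset.univ.filter fun x => ZMod.castHom h (ZMod m) x ∈ T

lemma residuePreimage_injective {m n : ℕ} [NeZero n] (h : m ∣ n) :
    Function.Injective (residuePreimage h) := by
  intro T U hTU
  ext y
  obtain ⟨x, rfl⟩ := ZMod.castHom_surjective h y
  simpa only [residuePreimage, Finset.mem_filter, Finset.mem_univ, true_and] using Finset.ext_iff.1 hTU x

lemma card_residuePreimage {m n : ℕ} [NeZero n] (h : m ∣ n) (T : Finset (ZMod m)) :
    (residuePreimage h T).card = n / m * T.card := by
  have : NeZero m := ⟨fun h0 => NeZero.ne n (by simpa [h0] using h)⟩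
  set π := (ZMod.castHom h (ZMod m)).toAddMonoidHom
  have hsurj : Function.Surjective π := ZMod.castHom_surjective h
  have hfib : ∀ U : Finset (ZMod m), (residuePreimage h U).card
      = U.card * (Finset.univ.filter fun x => π x = 0).card := by
    intro U
    rw [Finset.card_eq_sum_card_fiberwise (s := residuePreimage h U) (f := π) (t := U)
      (fun x hx => (Finset.mem_filter.1 hx).2), ← smul_eq_mul, ← Finset.sum_const]
    refine Finset.sum_congr rfl fun y hy => ?_
    rw [← AddMonoidHom.card_fiber_eq_of_mem_range π (hsurj y) (hsurj 0), residuePreimage,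
      Finset.filter_filter]
    congr 1
    ext x
    simp only [Finset.mem_filter, Finset.mem_univ, true_and, and_iff_right_iff_imp]
    rintro rfl
    exact hy
  have huniv := hfib Finset.univ
  have htop : residuePreimage h Finset.univ = Finset.univ := by simp [residuePreimage]
  rw [htop, Finset.card_univ, Finset.card_univ, ZMod.card, ZMod.card] at huniv
  rw [hfib T, mul_comm]
  congr 1
  conv_rhs => rw [huniv]
  rw [Nat.mul_div_cancel_left _ (NeZero.pos m)]

lemma periodic_iff_exists_residuePreimage {m n : ℕ} [NeZero n] (h : m ∣ n) (S : Finset (ZMod n)) :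
    Function.IsPeriodicPt (shiftOne n) m S ↔ ∃ T, residuePreimage h T = S := by
  rw [Function.IsPeriodicPt, Function.IsFixedPt]
  constructor
  · intro hS
    have hmul : ∀ j : ℕ, ∀ y ∈ S, y + (m : ZMod n) * j ∈ S := by
      intro j y hy
      induction j with
      | zero => simpa using hy
      | succ j ih =>
        rw [iterate_shiftOne] at hS
        rw [← hS]
        exact Finset.mem_image.2 ⟨_, ih, by push_cast; ring⟩
    refine ⟨S.image (ZMod.castHom h (ZMod m)), ?_⟩
    ext x
    simp only [residuePreimage, Finset.mem_filter, Finset.mem_univ, true_and, Finset.mem_image]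
    refine ⟨?_, fun hx => ⟨x, hx, rfl⟩⟩
    rintro ⟨y, hy, hxy⟩
    rw [← ZMod.natCast_zmod_val x, ← ZMod.natCast_zmod_val y, map_natCast, map_natCast,
      ZMod.natCast_eq_natCast_iff] at hxy
    have hmod : y.val ≡ x.val + n [MOD m] :=
      hxy.trans (by simpa using (Nat.ModEq.refl x.val).add (Nat.modEq_zero_iff_dvd.2 h).symm)
    have hle : y.val ≤ x.val + n := by have := y.val_lt; omega
    obtain ⟨j, hj⟩ := (Nat.modEq_iff_dvd' hle).1 hmod
    have hx : x = y + (m : ZMod n) * j := by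
      have : ((x.val + n : ℕ) : ZMod n) = ((y.val + m * j : ℕ) : ZMod n) := by
        congr 1; omega
      simpa using this
    rw [hx]
    exact hmul j y hy
  · rintro ⟨T, rfl⟩
    rw [iterate_shiftOne]
    apply Finset.eq_of_subset_of_card_le
    · intro x hx
      obtain ⟨y, hy, rfl⟩ := Finset.mem_image.1 hx
      simp only [residuePreimage, Finset.mem_filter, Finset.mem_univ, true_and] at hy ⊢
      rwa [map_add, map_natCast, ZMod.natCast_self, add_zero]
    · rw [Finset.card_image_of_injective _ (add_left_injective _)]

lemma card_periodic {k n d : ℕ} [NeZero n] (h : d ∣ n) :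
    ((Finset.univ.powersetCard k).filter fun S : Finset (ZMod n) =>
      Function.minimalPeriod (shiftOne n) S ∣ n / d).card
      = if d ∣ k then (n / d).choose (k / d) else 0 := by
  have hm : n / d ∣ n := Nat.div_dvd_of_dvd h
  have hd : 0 < d := Nat.pos_of_dvd_of_pos h (NeZero.pos n)
  have hdd : n / (n / d) = d := Nat.div_div_self h (NeZero.ne n)
  have : NeZero (n / d) := ⟨(Nat.div_pos (Nat.le_of_dvd (NeZero.pos n) h) hd).ne'⟩
  have hmem : ∀ S : Finset (ZMod n), Function.minimalPeriod (shiftOne n) S ∣ n / d ↔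
      ∃ T, residuePreimage hm T = S := fun S => by
    rw [← periodic_iff_exists_residuePreimage, Function.isPeriodicPt_iff_minimalPeriod_dvd]
  split_ifs with hk
  · have hcard : (n / d).choose (k / d) =
        (Finset.univ.powersetCard (k / d) : Finset (Finset (ZMod (n / d)))).card := by
      rw [Finset.card_powersetCard, Finset.card_univ, ZMod.card]
    rw [hcard, ← Finset.card_image_of_injective _ (residuePreimage_injective hm)]
    congr 1
    ext S
    rw [Finset.mem_filter, hmem]
    simp only [Finset.mem_powersetCard_univ, Finset.mem_image]
    constructor
    · rintro ⟨hS, T, rfl⟩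
      rw [card_residuePreimage, hdd] at hS
      exact ⟨T, by rw [← hS, Nat.mul_div_cancel_left _ hd], rfl⟩
    · rintro ⟨T, hT, rfl⟩
      exact ⟨by rw [card_residuePreimage, hdd, hT, Nat.mul_div_cancel' hk], T, rfl⟩
  · rw [Finset.card_eq_zero, Finset.filter_eq_empty_iff]
    intro S hS hp
    obtain ⟨T, rfl⟩ := (hmem S).1 hp
    rw [Finset.mem_powersetCard_univ, card_residuePreimage, hdd] at hS
    exact hk ⟨_, hS.symm⟩

lemma sum_moebius_of_dvd_div {n p : ℕ} (hn : n ≠ 0) (hp : p ∣ n) :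
    (∑ d ∈ n.divisors, if p ∣ n / d then ArithmeticFunction.moebius d else 0)
      = if p = n then 1 else 0 := by
  obtain ⟨q, rfl⟩ := hp
  have hp0 : p ≠ 0 := left_ne_zero_of_mul hn
  have hq0 : q ≠ 0 := right_ne_zero_of_mul hn
  have hset : (p * q).divisors.filter (fun d => p ∣ p * q / d) = q.divisors := by
    ext d
    simp only [Finset.mem_filter, Nat.mem_divisors]
    constructor
    · rintro ⟨⟨hd, -⟩, c, hc⟩
      refine ⟨⟨c, ?_⟩, hq0⟩
      have := Nat.mul_div_cancel' hd
      rw [hc] at this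
      exact Nat.eq_of_mul_eq_mul_left (Nat.pos_of_ne_zero hp0) (by rw [← this]; ring)
    · rintro ⟨hd, -⟩
      exact ⟨⟨hd.mul_left p, hn⟩, by rw [Nat.mul_div_assoc _ hd]; exact dvd_mul_right _ _⟩
  rw [← Finset.sum_filter, hset, ← ArithmeticFunction.coe_mul_zeta_apply,
    ArithmeticFunction.moebius_mul_coe_zeta, ArithmeticFunction.one_apply]
  congr 1
  rw [eq_comm (a := p), Nat.mul_eq_left hp0]

/-- Möbius inversion: `N_{k,n} = ∑_{d ∣ gcd(k,n)} μ(d)·C(n/d, k/d)`. -/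
theorem NN_eq_sum_moebius_choose (k n : ℕ) (hk : 1 ≤ k) (hkn : k ≤ n) :
    (NN k n : ℤ) = ∑ d ∈ (Nat.gcd k n).divisors,
      (ArithmeticFunction.moebius d) * (Nat.choose (n / d) (k / d) : ℤ) := by
  have : NeZero n := ⟨by omega⟩
  have hgcd : (Nat.gcd k n).divisors = n.divisors.filter (· ∣ k) := by
    ext d
    simp only [Nat.mem_divisors, Finset.mem_filter, Nat.dvd_gcd_iff, ne_eq, Nat.gcd_eq_zero_iff]
    have := NeZero.ne n
    tauto
  have hperiod : ∀ S : Finset (ZMod n), Function.minimalPeriod (shiftOne n) S ∣ n := fun S => by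
    rw [← Function.isPeriodicPt_iff_minimalPeriod_dvd, Function.IsPeriodicPt, Function.IsFixedPt,
      iterate_shiftOne]
    simp
  have hterm : ∀ d ∈ n.divisors, (if d ∣ k then ArithmeticFunction.moebius d *
      (Nat.choose (n / d) (k / d) : ℤ) else 0) = ∑ S ∈ Finset.univ.powersetCard k,
        if Function.minimalPeriod (shiftOne n) (S : Finset (ZMod n)) ∣ n / d
          then ArithmeticFunction.moebius d else 0 := by
    intro d hd
    rw [← Finset.sum_filter, Finset.sum_const, card_periodic (Nat.dvd_of_mem_divisors hd)]
    split_ifs <;> simp [mul_comm]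
  rw [hgcd, Finset.sum_filter, Finset.sum_congr rfl hterm, Finset.sum_comm,
    Finset.sum_congr rfl fun S _ => sum_moebius_of_dvd_div (NeZero.ne n) (hperiod S),
    NN_eq_card_filter_minimalPeriod hk hkn, Finset.card_filter]
  push_cast
  rfl
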